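/- For every demand-robust group Steiner tree instance on a weighted graph G=(V,E,w) with root r, scenarios S_1,…,S_m with inflation factors σ_1,…,σ_m, and optimal cost OPT, there exist a subset I ⊆ {1,…,m} and, for each i ∈ I, a minimal feasible solution M_i for scenario S_i, such that the first-stage set X_0 = ∪_{i∈I} M_i can be extended to a solution of cost at most 2·OPT; that is, there exist X_1,…,X_m ⊆ E such that X_0 ∪ X_i is feasible for S_i for every i ∈ {1,…,m} and max_{1≤i≤m} (w(X_0) + σ_i·w(X_i)) ≤ 2·OPT. -/

import Mathlib

/-- An edge set `F` connects vertices `u` and `v` if they lie in the same connected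
component of the graph with edge set `F`. -/
def EdgeConn {V : Type*} (F : Set (Sym2 V)) (u v : V) : Prop :=
  (SimpleGraph.fromEdgeSet F).Reachable u v

/-- Vertex sets `U` and `W` are connected by the edge set `F`. -/
def SetConn {V : Type*} (F : Set (Sym2 V)) (U W : Set V) : Prop :=
  ∃ u ∈ U, ∃ w ∈ W, EdgeConn F u w

/-- An edge set `X` is feasible for a group Steiner tree scenario (a list of groups `gs`)
on `(G, r)` if `X ⊆ E(G)` and `X` connects at least one vertex of each group to `r`. -/
def GSTScenFeasible {V : Type*} (G : SimpleGraph V) (r : V) (gs : List (Set V))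
    (X : Finset (Sym2 V)) : Prop :=
  ↑X ⊆ G.edgeSet ∧ ∀ g ∈ gs, SetConn (↑X) g {r}

/-- A minimal feasible solution for a scenario: feasible, and no proper subset is. -/
def GSTScenMinimal {V : Type*} (G : SimpleGraph V) (r : V) (gs : List (Set V))
    (X : Finset (Sym2 V)) : Prop :=
  GSTScenFeasible G r gs X ∧ ∀ Y : Finset (Sym2 V), Y ⊂ X → ¬ GSTScenFeasible G r gs Y

theorem GSTScenFeasible.of_subset {V : Type*} {G : SimpleGraph V} {r : V} {gs : List (Set V)}
    {X Y : Finset (Sym2 V)} (h : GSTScenFeasible G r gs X) (hXY : X ⊆ Y)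
    (hY : ↑Y ⊆ G.edgeSet) : GSTScenFeasible G r gs Y := by
  refine ⟨hY, fun g hg => ?_⟩
  obtain ⟨u, hu, v, hv, huv⟩ := h.2 g hg
  exact ⟨u, hu, v, hv,
    huv.mono (SimpleGraph.fromEdgeSet_mono (Finset.coe_subset.2 hXY))⟩

theorem GSTScenFeasible.exists_minimal_subset {V : Type*} {G : SimpleGraph V} {r : V}
    {gs : List (Set V)} {X : Finset (Sym2 V)} (h : GSTScenFeasible G r gs X) :
    ∃ M ⊆ X, GSTScenMinimal G r gs M := by
  induction X using Finset.strongInduction with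
  | H X ih =>
    by_cases hX : GSTScenMinimal G r gs X
    · exact ⟨X, subset_rfl, hX⟩
    · have : ∃ Y : Finset (Sym2 V), Y ⊂ X ∧ GSTScenFeasible G r gs Y := by
        by_contra! hY
        exact hX ⟨h, hY⟩
      obtain ⟨Y, hYX, hY⟩ := this
      obtain ⟨M, hMY, hM⟩ := ih Y hYX hY
      exact ⟨M, hMY.trans hYX.subset, hM⟩

/-- There is a subfamily of a finite family of sets whose union has at least half of its weight
in `B`, while the part of every other member outside this union has less than half of its weight
in `B`. -/
theorem exists_subfamily_half_weight {ι α : Type*} [Fintype ι] [DecidableEq α]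
    (w : α → ℝ) (B : Finset α) (M : ι → Finset α) :
    ∃ I : Finset ι,
      ∑ e ∈ I.sup M, w e ≤ 2 * ∑ e ∈ I.sup M ∩ B, w e ∧
      ∀ i ∉ I, 2 * ∑ e ∈ (M i \ I.sup M) ∩ B, w e < ∑ e ∈ M i \ I.sup M, w e := by
  classical
  obtain ⟨I, hI⟩ := Set.Finite.exists_maximal
    (s := {I : Finset ι | ∑ e ∈ I.sup M, w e ≤ 2 * ∑ e ∈ I.sup M ∩ B, w e})
    (Set.toFinite _) ⟨∅, by simp⟩
  have hP : ∑ e ∈ I.sup M, w e ≤ 2 * ∑ e ∈ I.sup M ∩ B, w e := hI.prop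
  refine ⟨I, hP, fun i hi => ?_⟩
  by_contra! hD
  have hmem : ∑ e ∈ (insert i I).sup M, w e ≤ 2 * ∑ e ∈ (insert i I).sup M ∩ B, w e := by
    have hsup : (insert i I).sup M = I.sup M ∪ M i \ I.sup M := by
      rw [Finset.sup_insert, Finset.union_sdiff_self_eq_union, Finset.union_comm]
      rfl
    have hdisj : Disjoint (I.sup M) (M i \ I.sup M) := Finset.disjoint_sdiff
    rw [hsup, Finset.union_inter_distrib_right, Finset.sum_union hdisj,
      Finset.sum_union (hdisj.mono Finset.inter_subset_left Finset.inter_subset_left)]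
    linarith
  exact hi (hI.le_of_ge hmem (Finset.subset_insert i I) (Finset.mem_insert_self i I))

/-- For every demand-robust group Steiner tree instance with scenarios
`scen 1, …, scen m`, inflation factors `σ`, and optimal cost at most `OPT` (witnessed by
the feasible solution `Y`), there are a subset `I` of scenarios and minimal feasible
solutions `M i` for `i ∈ I` such that the first-stage set `X₀ = ⋃_{i∈I} M i` extends to a
solution of cost at most `2·OPT`. -/
theorem demandRobust_GST_firstStage_structure {V : Type} [Fintype V] [DecidableEq V]
    (G : SimpleGraph V) (w : Sym2 V → ℝ) (r : V)
    (hG : G.Connected) (hw : ∀ e ∈ G.edgeSet, 1 ≤ w e)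
    (m : ℕ) (scen : Fin m → List (Set V)) (σ : Fin m → ℝ) (hσ : ∀ i, 1 ≤ σ i)
    (OPT : ℝ)
    (hOPT : ∃ Y : Fin (m + 1) → Finset (Sym2 V),
      (∀ i : Fin m, GSTScenFeasible G r (scen i) (Y 0 ∪ Y i.succ)) ∧
      (∀ i : Fin m, ∑ e ∈ Y 0, w e + σ i * ∑ e ∈ Y i.succ, w e ≤ OPT)) :
    ∃ (I : Finset (Fin m)) (M : Fin m → Finset (Sym2 V)),
      (∀ i ∈ I, GSTScenMinimal G r (scen i) (M i)) ∧
      ∃ X : Fin m → Finset (Sym2 V),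
        (∀ i : Fin m, GSTScenFeasible G r (scen i) (I.sup M ∪ X i)) ∧
        (∀ i : Fin m, ∑ e ∈ I.sup M, w e + σ i * ∑ e ∈ X i, w e ≤ 2 * OPT) := by
  obtain ⟨Y, hY, hcost⟩ := hOPT
  choose M hMY hM using fun i => (hY i).exists_minimal_subset
  obtain ⟨I, hI, hnot⟩ := exists_subfamily_half_weight w (Y 0) M
  have hpos : ∀ i : Fin m, ∀ e ∈ Y 0 ∪ Y i.succ, 0 ≤ w e := fun i e he =>
    zero_le_one.trans (hw e ((hY i).1 he))
  refine ⟨I, M, fun i _ => hM i, fun i => M i \ I.sup M, fun i => ?_, fun i => ?_⟩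
  · rw [Finset.union_sdiff_self_eq_union]
    refine (hM i).1.of_subset Finset.subset_union_right ?_
    intro e he
    rcases Finset.mem_union.1 he with he | he
    · obtain ⟨j, -, hj⟩ := Finset.mem_sup.1 he
      exact (hM j).1.1 hj
    · exact (hM i).1.1 he
  · have hfirst : ∑ e ∈ I.sup M ∩ Y 0, w e ≤ ∑ e ∈ Y 0, w e :=
      Finset.sum_le_sum_of_subset_of_nonneg Finset.inter_subset_right
        fun e he _ => hpos i e (Finset.mem_union_left _ he)
    have hsecond : ∑ e ∈ M i \ I.sup M, w e ≤ 2 * ∑ e ∈ Y i.succ, w e := by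
      by_cases hi : i ∈ I
      · have hsub : M i ⊆ I.sup M := Finset.le_sup (f := M) hi
        rw [Finset.sdiff_eq_empty_iff_subset.2 hsub, Finset.sum_empty]
        have := Finset.sum_nonneg fun e he => hpos i e (Finset.mem_union_right _ he)
        linarith
      · have hsplit := Finset.sum_inter_add_sum_sdiff (M i \ I.sup M) (Y 0) w
        have hle : ∑ e ∈ (M i \ I.sup M) \ Y 0, w e ≤ ∑ e ∈ Y i.succ, w e := by
          refine Finset.sum_le_sum_of_subset_of_nonneg ?_
            fun e he _ => hpos i e (Finset.mem_union_right _ he)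
          intro e he
          simp only [Finset.mem_sdiff] at he
          exact (Finset.mem_union.1 (hMY i he.1.1)).resolve_left he.2
        linarith [hnot i hi]
    have hmul := mul_le_mul_of_nonneg_left hsecond (zero_le_one.trans (hσ i))
    linarith [hcost i]
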